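/- arXiv:2512.01173 — 2 statements merged into one kernel-verified Lean document; each statement's English description precedes it below -/
import Mathlib

section
/- Let T : A(𝕋)₊ → A(𝕋)₊ be a surjective map satisfying (T f + T g)(𝕋) = (f + g)(𝕋) for all f, g ∈ A(𝕋)₊, and let ψ : ℤ → ℤ be a function such that for every n ∈ ℤ, T applied to the function z ↦ z^n equals the function z ↦ z^{ψ(n)}. Then ψ is a bijection of ℤ. -/
/-- The `n`-th Fourier coefficient of a function on the unit circle:
`f̂(n) = (1/2π) ∫₀^{2π} f(e^{iθ}) e^{-inθ} dθ`. -/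
noncomputable def fourierCoeffCircle (f : Circle → ℂ) (n : ℤ) : ℂ :=
  (1 / (2 * Real.pi)) * ∫ θ in (0:ℝ)..(2 * Real.pi),
    f (Circle.exp θ) * Complex.exp (-(n : ℂ) * Complex.I * θ)

/-- Membership in the Wiener algebra `A(𝕋)`: continuous functions on the circle
whose Fourier coefficients are absolutely summable. -/
def InWiener (f : Circle → ℂ) : Prop :=
  Continuous f ∧ Summable fun n : ℤ => ‖fourierCoeffCircle f n‖

/-- Membership in the positive cone `A(𝕋)₊`: members of the Wiener algebra all of
whose Fourier coefficients are nonnegative real numbers. -/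
def InWienerPlus (f : Circle → ℂ) : Prop :=
  InWiener f ∧ ∀ n : ℤ, ∃ r : ℝ, 0 ≤ r ∧ fourierCoeffCircle f n = (r : ℂ)

instance fact_zero_lt_two_pi : Fact (0 < 2 * Real.pi) := ⟨Real.two_pi_pos⟩

theorem fourierCoeffCircle_eq_fourierCoeff (f : Circle → ℂ) (n : ℤ) :
    fourierCoeffCircle f n =
      fourierCoeff (fun x : AddCircle (2 * Real.pi) => f (AddCircle.toCircle x)) n := by
  rw [fourierCoeff_eq_intervalIntegral _ n 0, fourierCoeffCircle, Complex.real_smul, zero_add]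
  push_cast
  congr 1
  refine intervalIntegral.integral_congr fun x _ => ?_
  have hpi : (Real.pi : ℂ) ≠ 0 := by exact_mod_cast Real.pi_ne_zero
  have hx : AddCircle.toCircle (x : AddCircle (2 * Real.pi)) = Circle.exp x := by
    rw [AddCircle.toCircle_apply_mk, div_self Real.two_pi_pos.ne', one_mul]
  simp only [fourier_coe_apply, smul_eq_mul, hx]
  rw [mul_comm]
  congr 2
  push_cast
  field_simp

theorem fourierCoeffCircle_zpow (k n : ℤ) :
    fourierCoeffCircle (fun z : Circle => (z : ℂ) ^ k) n = (Pi.single k 1 : ℤ → ℂ) n := by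
  rw [fourierCoeffCircle_eq_fourierCoeff, ← fourierCoeff_fourier (T := 2 * Real.pi)]
  congr 1
  ext x
  rw [fourier_apply, AddCircle.toCircle_zsmul, Circle.coe_zpow]

theorem continuous_circle_zpow (k : ℤ) : Continuous fun z : Circle => (z : ℂ) ^ k :=
  Continuous.zpow₀ continuous_subtype_val k fun z => Or.inl (Circle.coe_ne_zero z)

theorem inWienerPlus_zpow (k : ℤ) : InWienerPlus fun z : Circle => (z : ℂ) ^ k := by
  refine ⟨⟨continuous_circle_zpow k, ?_⟩, fun n => ⟨(Pi.single k 1 : ℤ → ℝ) n, ?_, ?_⟩⟩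
  · refine summable_of_ne_finset_zero (s := {k}) fun n hn => ?_
    rw [fourierCoeffCircle_zpow, Pi.single_eq_of_ne (by simpa using hn), norm_zero]
  · rcases eq_or_ne n k with rfl | h <;> simp [*]
  · rw [fourierCoeffCircle_zpow]
    rcases eq_or_ne n k with rfl | h <;> simp [*]

/-- The Fourier series of a function in the Wiener algebra converges to it pointwise. -/
theorem InWiener.hasSum {f : Circle → ℂ} (hf : InWiener f) (z : Circle) :
    HasSum (fun n : ℤ => fourierCoeffCircle f n * (z : ℂ) ^ n) (f z) := by
  let F : C(AddCircle (2 * Real.pi), ℂ) :=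
    ⟨fun x => f (AddCircle.toCircle x), hf.1.comp AddCircle.continuous_toCircle⟩
  have hF : fourierCoeff F = fourierCoeffCircle f :=
    funext fun n => (fourierCoeffCircle_eq_fourierCoeff f n).symm
  have hx : AddCircle.toCircle ((z : ℂ).arg : AddCircle (2 * Real.pi)) = z := by
    rw [AddCircle.toCircle_apply_mk, div_self Real.two_pi_pos.ne', one_mul, Circle.exp_arg]
  have h := has_pointwise_sum_fourier_series_of_summable (f := F) (hF ▸ hf.2.of_norm)
    ((z : ℂ).arg : AddCircle (2 * Real.pi))
  rw [hF] at h
  simpa [F, fourier_apply, AddCircle.toCircle_zsmul, hx] using h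

/-- Parseval's identity for unimodular functions. -/
theorem hasSum_sq_norm_fourierCoeffCircle {f : Circle → ℂ} (hf : Continuous f)
    (hnorm : ∀ z, ‖f z‖ = 1) : HasSum (fun n : ℤ => ‖fourierCoeffCircle f n‖ ^ 2) 1 := by
  let F : C(AddCircle (2 * Real.pi), ℂ) :=
    ⟨fun x => f (AddCircle.toCircle x), hf.comp AddCircle.continuous_toCircle⟩
  have h := hasSum_sq_fourierCoeff (ContinuousMap.toLp (E := ℂ) 2 AddCircle.haarAddCircle ℂ F)
  have hint : ∫ t, ‖ContinuousMap.toLp (E := ℂ) 2 AddCircle.haarAddCircle ℂ F t‖ ^ 2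
      ∂AddCircle.haarAddCircle = 1 := by
    rw [MeasureTheory.integral_congr_ae (g := fun _ => (1 : ℝ))]
    · simp
    · filter_upwards [ContinuousMap.coeFn_toLp (E := ℂ) (p := 2) (𝕜 := ℂ)
        AddCircle.haarAddCircle F] with t ht
      rw [ht]
      simp [F, hnorm]
  rw [hint] at h
  simpa only [fourierCoeff_toLp, F, ContinuousMap.coe_mk,
    ← fourierCoeffCircle_eq_fourierCoeff] using h

/-- Nonnegative reals whose sum and sum of squares are both `1` are concentrated at one index. -/
theorem exists_eq_single_of_hasSum_sq {ι : Type*} [DecidableEq ι] {a : ι → ℝ}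
    (ha : ∀ i, 0 ≤ a i) (h1 : HasSum a 1) (h2 : HasSum (fun i => a i ^ 2) 1) :
    ∃ i, a = Pi.single i 1 := by
  have hle (i) : a i ≤ 1 := le_hasSum h1 i fun j _ => ha j
  have h0 : HasSum (fun i => a i - a i ^ 2) 0 := by simpa using h1.sub h2
  have h01 := (hasSum_zero_iff_of_nonneg fun i => by
    show 0 ≤ a i - a i ^ 2
    nlinarith [ha i, hle i]).1 h0
  have hne : ∃ i, a i ≠ 0 := by
    by_contra! h
    have := h1.unique (by simp [funext h, hasSum_zero] : HasSum a 0)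
    norm_num at this
  obtain ⟨i, hi⟩ := hne
  have hi1 : a i = 1 := by
    have : a i * (1 - a i) = 0 := by
      have := congrFun h01 i
      simp only [Pi.zero_apply] at this
      linarith
    rcases mul_eq_zero.1 this with h | h
    · exact absurd h hi
    · linarith
  refine ⟨i, funext fun j => ?_⟩
  rcases eq_or_ne j i with rfl | hj
  · simp [hi1]
  · have := sum_le_hasSum {i, j} (fun k _ => ha k) h1
    rw [Finset.sum_pair hj.symm, hi1] at this
    rw [Pi.single_eq_of_ne hj]
    linarith [ha j]

/-- A unimodular function in the positive cone is a monomial. -/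
theorem InWienerPlus.exists_eq_zpow {f : Circle → ℂ} (hf : InWienerPlus f)
    (hnorm : ∀ z, ‖f z‖ = 1) : ∃ n : ℤ, f = fun z : Circle => (z : ℂ) ^ n := by
  choose a ha hfa using hf.2
  have hsum : HasSum (fun n => (a n : ℂ)) (f 1) := by
    simpa [hfa] using hf.1.hasSum 1
  have hs : Summable a := by
    simpa [hfa, abs_of_nonneg (ha _)] using hf.1.2
  have h1 : HasSum a 1 := by
    have he : f 1 = ((∑' n, a n : ℝ) : ℂ) :=
      hsum.unique (Complex.hasSum_ofReal.2 hs.hasSum)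
    have := hnorm 1
    rw [he, Complex.norm_real, Real.norm_of_nonneg (tsum_nonneg ha)] at this
    exact this ▸ hs.hasSum
  have h2 : HasSum (fun n => a n ^ 2) 1 := by
    simpa [hfa] using hasSum_sq_norm_fourierCoeffCircle hf.1.1 hnorm
  obtain ⟨n, rfl⟩ := exists_eq_single_of_hasSum_sq ha h1 h2
  refine ⟨n, funext fun z => (hf.1.hasSum z).unique ?_⟩
  convert hasSum_single n (f := fun m => fourierCoeffCircle f m * (z : ℂ) ^ m) ?_ using 1
  · simp [hfa]
  · intro m hm
    simp [hfa, hm]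

theorem exists_circle_zpow_add_zpow_eq_zero {n m : ℤ} (h : n ≠ m) :
    ∃ z : Circle, (z : ℂ) ^ n + (z : ℂ) ^ m = 0 := by
  have hd : (n : ℂ) - m ≠ 0 := by exact_mod_cast sub_ne_zero.2 h
  refine ⟨Circle.exp (Real.pi / (n - m)), ?_⟩
  have hz : (Circle.exp (Real.pi / (n - m)) : ℂ) ^ (n - m) = -1 := by
    rw [Circle.coe_exp, ← Complex.exp_int_mul, ← Complex.exp_pi_mul_I]
    congr 1
    push_cast
    field_simp
  rw [zpow_sub₀ (Circle.coe_ne_zero _), div_eq_iff (zpow_ne_zero m (Circle.coe_ne_zero _))] at hz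
  rw [hz]
  ring

theorem circle_zpow_injective :
    Function.Injective fun (n : ℤ) (z : Circle) => (z : ℂ) ^ n := by
  intro n m h
  by_contra hne
  obtain ⟨z, hz⟩ := exists_circle_zpow_add_zpow_eq_zero hne
  have hzm : (z : ℂ) ^ n = (z : ℂ) ^ m := congrFun h z
  rw [hzm, ← two_mul] at hz
  exact zpow_ne_zero m z.coe_ne_zero ((mul_eq_zero.1 hz).resolve_left two_ne_zero)

theorem psi_bijective (T : (Circle → ℂ) → (Circle → ℂ))
    (hmap : ∀ f, InWienerPlus f → InWienerPlus (T f))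
    (hsurj : ∀ g, InWienerPlus g → ∃ f, InWienerPlus f ∧ T f = g)
    (hspec : ∀ f g, InWienerPlus f → InWienerPlus g →
      (Set.range fun z => T f z + T g z) = (Set.range fun z => f z + g z))
    (ψ : ℤ → ℤ)
    (hψ : ∀ n : ℤ, T (fun z : Circle => (z : ℂ) ^ n) = fun z : Circle => (z : ℂ) ^ (ψ n)) :
    Function.Bijective ψ := by
  constructor
  · intro n m h
    by_contra hne
    obtain ⟨z, hz⟩ := exists_circle_zpow_add_zpow_eq_zero hne
    have hr := hspec _ _ (inWienerPlus_zpow n) (inWienerPlus_zpow m)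
    rw [hψ, hψ, h] at hr
    obtain ⟨w, hw⟩ := hr.symm ▸ Set.mem_range_self
      (f := fun z : Circle => (z : ℂ) ^ n + (z : ℂ) ^ m) z
    simp only [hz, ← two_mul] at hw
    exact zpow_ne_zero (ψ m) w.coe_ne_zero ((mul_eq_zero.1 hw).resolve_left two_ne_zero)
  · intro k
    obtain ⟨f, hf, hTf⟩ := hsurj _ (inWienerPlus_zpow k)
    have hnorm (z : Circle) : ‖f z‖ = 1 := by
      obtain ⟨w, hw⟩ := (hspec f f hf hf).symm ▸ Set.mem_range_self (f := fun z => f z + f z) z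
      simp only [hTf, ← two_mul] at hw
      rw [← mul_left_cancel₀ two_ne_zero hw, norm_zpow, Circle.norm_coe, one_zpow]
    obtain ⟨n, rfl⟩ := hf.exists_eq_zpow hnorm
    exact ⟨n, circle_zpow_injective ((hψ n).symm.trans hTf)⟩
end

section
/- Let T : A(𝕋)₊ → A(𝕋)₊ be a surjective map satisfying (T f + T g)(𝕋) = (f + g)(𝕋) for all f, g ∈ A(𝕋)₊. If additionally T fixes every monomial, i.e., for every n ∈ ℤ, T applied to the function z ↦ z^n equals z ↦ z^n, then T f = f for all f ∈ A(𝕋)₊. -/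
theorem fourierCoeffCircle_const_mul_zpow (c : ℂ) (n k : ℤ) :
    fourierCoeffCircle (fun z => c * (z : ℂ) ^ n) k = if k = n then c else 0 := by
  have hpi : (Real.pi : ℂ) ≠ 0 := by exact_mod_cast Real.pi_ne_zero
  have hint : ∀ θ : ℝ, c * ((Circle.exp θ : Circle) : ℂ) ^ n *
      Complex.exp (-(k : ℂ) * Complex.I * θ) =
        c * Complex.exp ((((n - k : ℤ) : ℂ) * Complex.I) * θ) := by
    intro θ
    rw [Circle.coe_exp, ← Complex.exp_int_mul, mul_assoc, ← Complex.exp_add]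
    congr 2
    push_cast
    ring
  simp only [fourierCoeffCircle, hint, intervalIntegral.integral_const_mul]
  split_ifs with h
  · subst h
    simp
    field_simp
  · have hnk : (((n - k : ℤ) : ℂ) * Complex.I) ≠ 0 :=
      mul_ne_zero (by exact_mod_cast sub_ne_zero.mpr (Ne.symm h)) Complex.I_ne_zero
    have hexp : Complex.exp ((((n - k : ℤ) : ℂ) * Complex.I) * ((2 * Real.pi : ℝ) : ℂ)) = 1 := by
      rw [Complex.exp_eq_one_iff]
      exact ⟨n - k, by push_cast; ring⟩
    rw [integral_exp_mul_complex hnk, hexp]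
    simp

theorem InWienerPlus.const_mul_zpow {c : ℝ} (hc : 0 ≤ c) (n : ℤ) :
    InWienerPlus (fun z : Circle => (c : ℂ) * (z : ℂ) ^ n) := by
  refine ⟨⟨?_, ?_⟩, fun k => ?_⟩
  · exact continuous_const.mul
      (continuous_subtype_val.zpow₀ n fun z => Or.inl (Circle.coe_ne_zero z))
  · refine summable_of_ne_finset_zero (s := {n}) fun k hk => ?_
    rw [fourierCoeffCircle_const_mul_zpow, if_neg (by simpa using hk), norm_zero]
  · rw [fourierCoeffCircle_const_mul_zpow]
    split_ifs
    · exact ⟨c, hc, rfl⟩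
    · exact ⟨0, le_rfl, by simp⟩

theorem eq_smul_of_norm_add_eq {E : Type*} [NormedAddCommGroup E] [InnerProductSpace ℝ E]
    {h u : E} {c : ℝ} (hu : ‖u‖ = 1) (hh : ‖h‖ = c) (hhu : ‖h + u‖ = c + 1) :
    h = c • u := by
  have hadd := norm_add_sq_real h u
  have hsub := norm_sub_sq_real h (c • u)
  rw [inner_smul_right, norm_smul, hu, hh, mul_one, Real.norm_eq_abs, sq_abs] at hsub
  rw [hhu, hh, hu] at hadd
  have hinner : inner ℝ h u = c := by linarith
  rw [hinner] at hsub
  have : ‖h - c • u‖ ^ 2 = 0 := by rw [hsub]; ring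
  exact sub_eq_zero.mp (norm_eq_zero.mp (pow_eq_zero_iff two_ne_zero |>.mp this))

/-- Comparing ranges after adding large multiples of a homeomorphic unimodular function `u`
compares the components along `u`. -/
theorem inner_le_of_range_add_smul_subset {X E : Type*} [TopologicalSpace X] [CompactSpace X]
    [NormedAddCommGroup E] [InnerProductSpace ℝ E] {f g u : X → E} (hg : Continuous g)
    (hu : Topology.IsInducing u) (hu1 : ∀ x, ‖u x‖ = 1)
    (h : ∀ c : ℕ, (Set.range fun x => f x + (c : ℝ) • u x) ⊆
      Set.range fun x => g x + (c : ℝ) • u x) (x : X) :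
    inner ℝ (f x) (u x) ≤ inner ℝ (g x) (u x) := by
  choose y hy using fun c : ℕ => h c ⟨x, rfl⟩
  simp only at hy
  obtain ⟨M, hM⟩ := isCompact_univ.exists_bound_of_continuousOn hg.continuousOn
  have hbound : ∀ c : ℕ, (c : ℝ) * ‖u (y c) - u x‖ ≤ ‖f x‖ + M := by
    intro c
    have heq : (c : ℝ) • (u (y c) - u x) = f x - g (y c) := by
      rw [smul_sub, sub_eq_sub_iff_add_eq_add, add_comm, hy]
    calc (c : ℝ) * ‖u (y c) - u x‖ = ‖(c : ℝ) • (u (y c) - u x)‖ := by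
          rw [norm_smul, Real.norm_natCast]
      _ ≤ ‖f x‖ + M := by
          rw [heq]
          exact (norm_sub_le _ _).trans (by gcongr; exact hM _ trivial)
  have hlim : Filter.Tendsto y Filter.atTop (nhds x) := by
    rw [hu.tendsto_nhds_iff, tendsto_iff_norm_sub_tendsto_zero]
    refine squeeze_zero' (g := fun c : ℕ => (‖f x‖ + M) / c)
      (Filter.Eventually.of_forall fun _ => norm_nonneg _) ?_ (tendsto_const_div_atTop_nhds_zero_nat _)
    filter_upwards [Filter.eventually_gt_atTop 0] with c hc
    rw [le_div_iff₀ (by exact_mod_cast hc), mul_comm]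
    exact hbound c
  have hlimg : Filter.Tendsto (fun c => inner ℝ (g (y c)) (u x)) Filter.atTop
      (nhds (inner ℝ (g x) (u x))) :=
    ((hg.tendsto x).comp hlim).inner tendsto_const_nhds
  refine ge_of_tendsto' hlimg fun c => ?_
  have hin := congrArg (fun v => inner ℝ v (u x)) (hy c)
  simp only [inner_add_left, inner_smul_left, real_inner_self_eq_norm_sq, hu1] at hin
  have hle : inner ℝ (u (y c)) (u x) ≤ 1 := by
    simpa [hu1] using real_inner_le_norm (u (y c)) (u x)
  have hc : (0 : ℝ) ≤ c := c.cast_nonneg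
  simp only [conj_trivial] at hin
  nlinarith

theorem inner_eq_of_range_add_smul_eq {X E : Type*} [TopologicalSpace X] [CompactSpace X]
    [NormedAddCommGroup E] [InnerProductSpace ℝ E] {f g u : X → E} (hf : Continuous f)
    (hg : Continuous g) (hu : Topology.IsInducing u) (hu1 : ∀ x, ‖u x‖ = 1)
    (h : ∀ c : ℕ, (Set.range fun x => f x + (c : ℝ) • u x) =
      Set.range fun x => g x + (c : ℝ) • u x) (x : X) :
    inner ℝ (f x) (u x) = inner ℝ (g x) (u x) :=
  le_antisymm (inner_le_of_range_add_smul_subset hg hu hu1 (fun c => (h c).subset) x)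
    (inner_le_of_range_add_smul_subset hf hu hu1 (fun c => (h c).superset) x)

theorem Real.dense_sin_two_mul_ne_zero : Dense {θ : ℝ | Real.sin (2 * θ) ≠ 0} := by
  have hcount : {θ : ℝ | Real.sin (2 * θ) = 0}.Countable := by
    refine (Set.countable_range fun n : ℤ => (n : ℝ) * Real.pi / 2).mono fun θ hθ => ?_
    obtain ⟨n, hn⟩ := Real.sin_eq_zero_iff.mp hθ
    exact ⟨n, by simp only; linarith⟩
  exact hcount.dense_compl ℝ

/-- A continuous function on the circle is determined by its components along `z` and `z⁻¹`. -/
theorem Circle.eq_of_inner_eq {f g : Circle → ℂ} (hf : Continuous f) (hg : Continuous g)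
    (h : ∀ z : Circle, inner ℝ (f z) (z : ℂ) = inner ℝ (g z) (z : ℂ))
    (hinv : ∀ z : Circle, inner ℝ (f z) ((z⁻¹ : Circle) : ℂ) =
      inner ℝ (g z) ((z⁻¹ : Circle) : ℂ)) :
    f = g := by
  have hexp : (fun θ : ℝ => f (Circle.exp θ)) = fun θ => g (Circle.exp θ) := by
    refine Continuous.ext_on Real.dense_sin_two_mul_ne_zero (hf.comp Circle.exp.continuous)
      (hg.comp Circle.exp.continuous) fun θ hθ => ?_
    have h₁ := h (Circle.exp θ)
    have h₂ := hinv (Circle.exp θ)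
    rw [Circle.coe_inv_eq_conj] at h₂
    simp only [Complex.inner, Complex.mul_re, Complex.conj_re, Complex.conj_im, Circle.coe_exp,
      Complex.exp_ofReal_mul_I_re, Complex.exp_ofReal_mul_I_im] at h₁ h₂
    rw [Set.mem_ofPred_eq, Real.sin_two_mul] at hθ
    have hsin : Real.sin θ ≠ 0 := fun h0 => hθ (by simp [h0])
    have hcos : Real.cos θ ≠ 0 := fun h0 => hθ (by simp [h0])
    refine Complex.ext (mul_left_cancel₀ hcos ?_) (mul_left_cancel₀ hsin ?_) <;> linarith
  funext z
  obtain ⟨θ, rfl⟩ := Circle.exp_surjective z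
  exact congrFun hexp θ

section RangePreserving

variable {T : (Circle → ℂ) → (Circle → ℂ)}

theorem map_const_mul_zpow
    (hspec : ∀ f g, InWienerPlus f → InWienerPlus g →
      (Set.range fun z => T f z + T g z) = (Set.range fun z => f z + g z))
    (hmono : ∀ n : ℤ, T (fun z : Circle => (z : ℂ) ^ n) = fun z : Circle => (z : ℂ) ^ n)
    {c : ℝ} (hc : 0 ≤ c) (n : ℤ) :
    T (fun z : Circle => (c : ℂ) * (z : ℂ) ^ n) = fun z : Circle => (c : ℂ) * (z : ℂ) ^ n := by
  have hmem := InWienerPlus.const_mul_zpow hc n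
  have hmem₁ : InWienerPlus (fun z : Circle => (z : ℂ) ^ n) := by
    simpa using InWienerPlus.const_mul_zpow zero_le_one n
  have hunit : ∀ z : Circle, ‖(z : ℂ) ^ n‖ = 1 := fun z => by
    rw [norm_zpow, Circle.norm_coe, one_zpow]
  funext z
  have hnorm : ‖T (fun z : Circle => (c : ℂ) * (z : ℂ) ^ n) z‖ = c := by
    obtain ⟨w, hw⟩ := (hspec _ _ hmem hmem).subset ⟨z, rfl⟩
    simp only [← two_mul] at hw
    rw [← mul_left_cancel₀ two_ne_zero hw, norm_mul, hunit, mul_one, Complex.norm_real,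
      Real.norm_of_nonneg hc]
  have hnorm_add : ‖T (fun z : Circle => (c : ℂ) * (z : ℂ) ^ n) z + (z : ℂ) ^ n‖ = c + 1 := by
    obtain ⟨w, hw⟩ := (hspec _ _ hmem hmem₁).subset ⟨z, rfl⟩
    simp only [hmono] at hw
    rw [← hw, ← add_one_mul, norm_mul, hunit, mul_one]
    exact_mod_cast Real.norm_of_nonneg (by positivity : 0 ≤ c + 1)
  simpa using eq_smul_of_norm_add_eq (hunit z) hnorm hnorm_add

theorem inner_map_zpow_eq
    (hmap : ∀ f, InWienerPlus f → InWienerPlus (T f))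
    (hspec : ∀ f g, InWienerPlus f → InWienerPlus g →
      (Set.range fun z => T f z + T g z) = (Set.range fun z => f z + g z))
    (hmono : ∀ n : ℤ, T (fun z : Circle => (z : ℂ) ^ n) = fun z : Circle => (z : ℂ) ^ n)
    {f : Circle → ℂ} (hf : InWienerPlus f) {n : ℤ}
    (hn : Topology.IsInducing fun z : Circle => (z : ℂ) ^ n) (z : Circle) :
    inner ℝ (T f z) ((z : ℂ) ^ n) = inner ℝ (f z) ((z : ℂ) ^ n) := by
  refine inner_eq_of_range_add_smul_eq (hmap f hf).1.1 hf.1.1 hn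
    (fun z => by rw [norm_zpow, Circle.norm_coe, one_zpow]) (fun c => ?_) z
  have h := hspec _ _ hf (InWienerPlus.const_mul_zpow c.cast_nonneg n)
  rw [map_const_mul_zpow hspec hmono c.cast_nonneg n] at h
  simpa using h

end RangePreserving

theorem T_eq_id_of_fixes_monomials (T : (Circle → ℂ) → (Circle → ℂ))
    (hmap : ∀ f, InWienerPlus f → InWienerPlus (T f))
    (hsurj : ∀ g, InWienerPlus g → ∃ f, InWienerPlus f ∧ T f = g)
    (hspec : ∀ f g, InWienerPlus f → InWienerPlus g →
      (Set.range fun z => T f z + T g z) = (Set.range fun z => f z + g z))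
    (hmono : ∀ n : ℤ, T (fun z : Circle => (z : ℂ) ^ n) = fun z : Circle => (z : ℂ) ^ n) :
    ∀ f, InWienerPlus f → T f = f := by
  intro f hf
  have hone : Topology.IsInducing fun z : Circle => (z : ℂ) ^ (1 : ℤ) := by
    simpa using (⟨rfl⟩ : Topology.IsInducing fun z : Circle => (z : ℂ))
  have hneg : Topology.IsInducing fun z : Circle => (z : ℂ) ^ (-1 : ℤ) := by
    simpa [Function.comp_def] using hone.comp (Homeomorph.inv Circle).isInducing
  refine Circle.eq_of_inner_eq (hmap f hf).1.1 hf.1.1 (fun z => ?_) fun z => ?_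
  · simpa using inner_map_zpow_eq hmap hspec hmono hf hone z
  · simpa using inner_map_zpow_eq hmap hspec hmono hf hneg z
end
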